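/- arXiv:1901.01782 — 2 statements merged into one kernel-verified Lean document; each statement's English description precedes it below -/
import Mathlib

section
/- For every integer m ≥ 1 there exists a constant C > 0, depending only on m, with the following property. Let n be a positive integer, let μ be a Borel measure on ℝⁿ, let E ⊆ ℝⁿ, and suppose there are constants c > 0 and r₀ > 0 such that μ(closedBall(x,r)) ≥ c·r^m for every x ∈ E and every r ∈ (0, r₀). Then limsup_{r → 0⁺} μ(thickening of E by r)/(2r) ≥ C·c·H^{m−1}(E), where H^{m−1} denotes the (m−1)-dimensional Hausdorff measure on ℝⁿ. -/
open MeasureTheory Metric Filter Set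

/-- Every subset of a pseudometric space contains an `r`-separated net of radius `r`. -/
theorem exists_separated_net {X : Type*} [PseudoMetricSpace X] (E : Set X) {r : ℝ} (hr : 0 ≤ r) :
    ∃ N ⊆ E, N.Pairwise (fun x y => r < dist x y) ∧ E ⊆ ⋃ x : N, closedBall (x : X) r := by
  obtain ⟨N, hN⟩ := zorn_subset {N : Set X | N ⊆ E ∧ N.Pairwise (fun x y => r < dist x y)}
    fun c hc hchain => ⟨⋃₀ c, ⟨sUnion_subset fun s hs => (hc hs).1,
      (pairwise_sUnion hchain.directedOn).2 fun s hs => (hc hs).2⟩,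
      fun s hs => subset_sUnion_of_mem hs⟩
  refine ⟨N, hN.prop.1, hN.prop.2, fun x hx => ?_⟩
  by_contra hcover
  have hfar : ∀ y ∈ N, r < dist x y := by simpa using hcover
  have hinsert : insert x N ⊆ N :=
    hN.le_of_ge ⟨insert_subset hx hN.prop.1, hN.prop.2.insert fun y hy _ =>
      ⟨hfar y hy, dist_comm x y ▸ hfar y hy⟩⟩ (subset_insert x N)
  exact (hfar x (hinsert (mem_insert x N))).not_ge (by simpa using hr)

/-- The half-radius closed balls around an `r`-separated set are disjoint. -/
theorem pairwiseDisjoint_closedBall_half {X : Type*} [PseudoMetricSpace X] {N : Set X} {r : ℝ}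
    (hN : N.Pairwise (fun x y => r < dist x y)) :
    N.PairwiseDisjoint fun x => closedBall x (r / 2) := fun x hx y hy hxy =>
  closedBall_disjoint_closedBall (by simpa using hN hx hy hxy)

/-- If `μ` gives mass at least `a` to all closed balls of radius `r / 2` centred in `E`, then `E`
has a countable net of radius `r` whose cardinality times `a` is at most the mass of the
`r`-thickening of `E`. -/
theorem exists_countable_net_tsum_le_thickening {X : Type*} [PseudoMetricSpace X]
    [TopologicalSpace.SeparableSpace X] [MeasurableSpace X] [OpensMeasurableSpace X]
    (μ : Measure X) (E : Set X) {r : ℝ} (hr : 0 < r) {a : ENNReal}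
    (ha : ∀ x ∈ E, a ≤ μ (closedBall x (r / 2))) :
    ∃ N : Set X, N.Countable ∧ E ⊆ (⋃ x : N, closedBall (x : X) r) ∧
      ∑' _ : N, a ≤ μ (thickening r E) := by
  obtain ⟨N, hNE, hsep, hcover⟩ := exists_separated_net E hr.le
  have hdisj := pairwiseDisjoint_closedBall_half hsep
  refine ⟨N, hdisj.countable_of_nonempty_interior fun x _ =>
    ⟨x, ball_subset_interior_closedBall (mem_ball_self (by positivity))⟩, hcover, ?_⟩
  calc ∑' _ : N, a ≤ ∑' x : N, μ (closedBall (x : X) (r / 2)) :=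
        ENNReal.tsum_le_tsum fun x => ha x (hNE x.2)
    _ ≤ μ (⋃ x : N, closedBall (x : X) (r / 2)) :=
        tsum_meas_le_meas_iUnion_of_disjoint μ (fun _ => isClosed_closedBall.measurableSet)
          (hdisj.subtype _ _)
    _ ≤ μ (thickening r E) := by
        refine measure_mono (iUnion_subset fun x => ?_)
        exact (closedBall_subset_ball (by linarith)).trans (ball_subset_thickening (hNE x.2) r)

/-- For every integer `m ≥ 1` there is a constant `C > 0`, depending only on `m`, such that:
for every `n > 0`, every Borel measure `μ` on `ℝⁿ`, every set `E ⊆ ℝⁿ` and all constants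
`c > 0`, `r₀ > 0` with `μ(closedBall x r) ≥ c rᵐ` for all `x ∈ E` and `r ∈ (0, r₀)`, one has
`limsup_{r → 0⁺} μ(B(E,r))/(2r) ≥ C · c · H^{m-1}(E)`. -/
theorem limsup_thickening_ge_hausdorff (m : ℕ) (hm : 1 ≤ m) :
    ∃ C : ℝ, 0 < C ∧
      ∀ (n : ℕ), 0 < n →
        ∀ (μ : Measure (EuclideanSpace ℝ (Fin n))) (E : Set (EuclideanSpace ℝ (Fin n)))
          (c r₀ : ℝ), 0 < c → 0 < r₀ →
          (∀ x ∈ E, ∀ r : ℝ, 0 < r → r < r₀ →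
            ENNReal.ofReal (c * r ^ m) ≤ μ (Metric.closedBall x r)) →
          ENNReal.ofReal (C * c) * μH[(m : ℝ) - 1] E ≤
            Filter.limsup (fun r : ℝ => μ (Metric.thickening r E) / ENNReal.ofReal (2 * r))
              (nhdsWithin 0 (Set.Ioi 0)) := by
  refine ⟨(4 ^ m)⁻¹, by positivity, fun n _ μ E c r₀ hc hr₀ hμ => ?_⟩
  obtain ⟨k, rfl⟩ := Nat.exists_eq_add_of_le' hm
  have hnet : ∀ r : ℝ, ∃ N : Set (EuclideanSpace ℝ (Fin n)), N.Countable ∧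
      (0 < r → r < r₀ → E ⊆ (⋃ x : N, closedBall (x : EuclideanSpace ℝ (Fin n)) r) ∧
        ∑' _ : N, ENNReal.ofReal (c * (r / 2) ^ (k + 1)) ≤ μ (thickening r E)) := by
    intro r
    by_cases h : 0 < r ∧ r < r₀
    · obtain ⟨N, hN, hN'⟩ := exists_countable_net_tsum_le_thickening μ E h.1
        fun x hx => hμ x hx (r / 2) (by linarith) (by linarith)
      exact ⟨N, hN, fun _ _ => hN'⟩
    · exact ⟨∅, countable_empty, fun h₁ h₂ => (h ⟨h₁, h₂⟩).elim⟩
  choose N hNc hN using hnet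
  have : ∀ r, Countable (N r) := fun r => (hNc r).to_subtype
  have hsmall : ∀ᶠ r : ℝ in nhdsWithin 0 (Ioi 0), 0 < r ∧ r < r₀ :=
    Ioo_mem_nhdsGT hr₀
  have htendsto : Tendsto (fun r : ℝ => ENNReal.ofReal (2 * r)) (nhdsWithin 0 (Ioi 0)) (nhds 0) := by
    have : Continuous fun r : ℝ => ENNReal.ofReal (2 * r) :=
      ENNReal.continuous_ofReal.comp (continuous_const_mul 2)
    simpa using (this.tendsto 0).mono_left nhdsWithin_le_nhds
  have hdiam : ∀ r : ℝ, 0 < r → ∀ x : EuclideanSpace ℝ (Fin n),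
      ediam (closedBall x r) ≤ ENNReal.ofReal (2 * r) := by
    intro r hr x
    rw [← closedEBall_ofReal hr.le, ENNReal.ofReal_mul zero_le_two, ENNReal.ofReal_ofNat]
    exact ediam_closedEBall_le
  have hH := Measure.hausdorffMeasure_le_liminf_tsum (((k + 1 : ℕ) : ℝ) - 1) E
    (fun r : ℝ => ENNReal.ofReal (2 * r)) htendsto
    (fun r (x : N r) => closedBall (x : EuclideanSpace ℝ (Fin n)) r)
    (hsmall.mono fun r hr x => hdiam r hr.1 x) (hsmall.mono fun r hr => (hN r hr.1 hr.2).1)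
  refine (mul_le_mul_right (hH.trans liminf_le_limsup) _).trans ?_
  rw [← ENNReal.limsup_const_mul_of_ne_top ENNReal.ofReal_ne_top]
  refine limsup_le_limsup (hsmall.mono fun r ⟨hr, hr'⟩ => ?_)
  beta_reduce
  rw [ENNReal.le_div_iff_mul_le (by simp [hr]) (.inl ENNReal.ofReal_ne_top), ← ENNReal.tsum_mul_left,
    ← ENNReal.tsum_mul_right]
  refine (ENNReal.tsum_le_tsum fun x => ?_).trans (hN r hr hr').2
  have hexp : (0 : ℝ) ≤ ((k + 1 : ℕ) : ℝ) - 1 := by simp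
  calc ENNReal.ofReal ((4 ^ (k + 1))⁻¹ * c) *
          ediam (closedBall (x : EuclideanSpace ℝ (Fin n)) r) ^ (((k + 1 : ℕ) : ℝ) - 1) *
          ENNReal.ofReal (2 * r)
      ≤ ENNReal.ofReal ((4 ^ (k + 1))⁻¹ * c) *
          ENNReal.ofReal (2 * r) ^ (((k + 1 : ℕ) : ℝ) - 1) * ENNReal.ofReal (2 * r) := by
        gcongr
        exact hdiam r hr x
    _ = ENNReal.ofReal (c * (r / 2) ^ (k + 1)) := by
        rw [Nat.cast_add_one, add_sub_cancel_right, ENNReal.rpow_natCast,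
          ← ENNReal.ofReal_pow (by positivity), ← ENNReal.ofReal_mul (by positivity),
          ← ENNReal.ofReal_mul (by positivity)]
        congr 1
        rw [mul_assoc, ← pow_succ, show r / 2 = 2 * r / 4 by ring, div_pow]
        ring
end

section
/- Let a = h = 1/3 and λ = 1/4 (with any admissible transition function φ), let ψ and y_∞ be as in the construction, let M := {(x, y, ψ(x,y)) : (x,y) ∈ (0,π) × (0,y_∞)} ⊆ ℝ³ and E := [0,π] × {y_∞} × [−1,1]. Then there exists a map ω : ℝ³ → (ℝ³ →L[ℝ] ℝ) (a 1-form on ℝ³) such that: (i) ω is continuous on ℝ³ and ω(p) = 0 for every p ∈ E; (ii) ω is continuously differentiable on ℝ³ ∖ E; (iii) for every p = (x, y, ψ(x,y)) ∈ M and every pair of vectors u, v in the tangent plane to M at p (the linear span of (1, 0, ∂₁ψ(x,y)) and (0, 1, ∂₂ψ(x,y))), one has (Dω(p)·u)(v) = (Dω(p)·v)(u), where Dω(p) is the (Fréchet) derivative of ω at p — i.e. the exterior derivative dω vanishes on the tangent planes of M; (iv) the circulation of ω along the positively oriented boundary of the rectangle [0,π] × [0,y_∞] × {0}, namely ∫_0^π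 ω(t,0,0)(e₁) dt + ∫_0^{y_∞} ω(π,t,0)(e₂) dt − ∫_0^π ω(t,y_∞,0)(e₁) dt − ∫_0^{y_∞} ω(0,t,0)(e₂) dt, equals 1. (Hence the generalized Stokes' theorem fails for the integral current carried by the graph of ψ, whose singular set is the segment E of finite 1-dimensional Hausdorff measure.) -/
open Real MeasureTheory Set Filter

noncomputable section

namespace StokesCounterexample

/-- `ySeq a k = Σ_{j=1}^k a^j` (so `ySeq a 0 = 0`). -/
def ySeq (a : ℝ) (k : ℕ) : ℝ := ∑ j ∈ Finset.range k, a ^ (j + 1)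

/-- `yInf a = Σ_{j=1}^∞ a^j = a / (1 - a)`. -/
def yInf (a : ℝ) : ℝ := a / (1 - a)

/-- `fSeq h l 0 = 0` and `fSeq h l k x = h^k · sin (x / l^k)` for `k ≥ 1`. -/
def fSeq (h l : ℝ) (k : ℕ) (x : ℝ) : ℝ :=
  if k = 0 then 0 else h ^ k * Real.sin (x / l ^ k)

open Classical in
/-- The interpolation `ψ(x,y) = (1 - φ_k(y))·f_k(x) + φ_k(y)·f_{k+1}(x)` for
`y ∈ [y_k, y_{k+1})`, where `φ_k(y) = φ((y - y_k)/a^(k+1))`, extended by `0`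
outside of `⋃_k [y_k, y_{k+1})` (in particular `ψ(x, y_∞) = 0`). -/
def psi (a h l : ℝ) (φ : ℝ → ℝ) (x y : ℝ) : ℝ :=
  if hk : ∃ k : ℕ, ySeq a k ≤ y ∧ y < ySeq a (k + 1) then
    (1 - φ ((y - ySeq a hk.choose) / a ^ (hk.choose + 1))) * fSeq h l hk.choose x
      + φ ((y - ySeq a hk.choose) / a ^ (hk.choose + 1)) * fSeq h l (hk.choose + 1) x
  else 0

/-- The partial derivative of `ψ` in the first variable. -/
def psi₁ (a h l : ℝ) (φ : ℝ → ℝ) (x y : ℝ) : ℝ :=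
  deriv (fun t => psi a h l φ t y) x

/-- The partial derivative of `ψ` in the second variable. -/
def psi₂ (a h l : ℝ) (φ : ℝ → ℝ) (x y : ℝ) : ℝ :=
  deriv (fun s => psi a h l φ x s) y

/-- The arc length `L(x,y) = ∫_0^x √(1 + (∂₁ψ(t,y))²) dt`. -/
def arc (a h l : ℝ) (φ : ℝ → ℝ) (x y : ℝ) : ℝ :=
  ∫ t in (0:ℝ)..x, Real.sqrt (1 + psi₁ a h l φ t y ^ 2)

/-- The length `L(y) = L(π, y)` of the section of the graph of `ψ` at height `y`. -/
def len (a h l : ℝ) (φ : ℝ → ℝ) (y : ℝ) : ℝ := arc a h l φ π y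

/-- The singular segment `E = [0,π] × {y_∞} × [-1,1] ⊆ ℝ³` for the parameters
`a = h = 1/3`, `λ = 1/4`. -/
def Eseg : Set (ℝ × ℝ × ℝ) :=
  Icc 0 π ×ˢ ({yInf (1/3)} : Set ℝ) ×ˢ Icc (-1 : ℝ) 1

open scoped Topology

/-! ### The heights `y_k` for `a = 1/3` -/

lemma ySeq_third (k : ℕ) : ySeq (1/3) k = (1 - (1/3) ^ k) / 2 := by
  induction k with
  | zero => simp [ySeq]
  | succ k ih =>
    have : ySeq (1/3) (k + 1) = ySeq (1/3) k + (1/3) ^ (k + 1) := by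
      simp [ySeq, Finset.sum_range_succ]
    rw [this, ih]; ring

lemma yInf_third : yInf (1/3) = 1/2 := by norm_num [yInf]

lemma ySeq_third_strictMono : StrictMono (ySeq (1/3)) := by
  refine strictMono_nat_of_lt_succ fun k => ?_
  rw [ySeq_third, ySeq_third, pow_succ]
  have : (0:ℝ) < (1/3) ^ k := by positivity
  linarith

lemma ySeq_third_lt (k : ℕ) : ySeq (1/3) k < 1/2 := by
  rw [ySeq_third]
  have : (0:ℝ) < (1/3) ^ k := by positivity
  linarith

lemma exists_level {y : ℝ} (h0 : 0 ≤ y) (h1 : y < 1/2) :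
    ∃ k : ℕ, ySeq (1/3) k ≤ y ∧ y < ySeq (1/3) (k + 1) := by
  obtain ⟨n, hn, hn'⟩ := exists_nat_pow_near_of_lt_one (x := 1 - 2 * y) (y := 1/3)
    (by linarith) (by linarith) (by norm_num) (by norm_num)
  refine ⟨n, ?_, ?_⟩ <;> rw [ySeq_third] <;> linarith

open Classical in
/-- The index `k` with `y_k ≤ y < y_{k+1}`, and `0` if there is none. -/
def level (y : ℝ) : ℕ :=
  if hk : ∃ k : ℕ, ySeq (1/3) k ≤ y ∧ y < ySeq (1/3) (k + 1) then hk.choose else 0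

lemma level_eq {y : ℝ} {k : ℕ} (h0 : ySeq (1/3) k ≤ y) (h1 : y < ySeq (1/3) (k + 1)) :
    level y = k := by
  have hk : ∃ k : ℕ, ySeq (1/3) k ≤ y ∧ y < ySeq (1/3) (k + 1) := ⟨k, h0, h1⟩
  rw [level, dif_pos hk]
  obtain ⟨h2, h3⟩ := hk.choose_spec
  have h4 := ySeq_third_strictMono.lt_iff_lt.1 (h0.trans_lt h3)
  have h5 := ySeq_third_strictMono.lt_iff_lt.1 (h2.trans_lt h1)
  omega

lemma level_of_neg {y : ℝ} (hy : y < 0) : level y = 0 := by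
  rw [level, dif_neg]
  rintro ⟨k, hk, -⟩
  have : ySeq (1/3) 0 ≤ ySeq (1/3) k := ySeq_third_strictMono.monotone (Nat.zero_le k)
  simp only [ySeq_third, pow_zero] at this hk
  linarith

/-- The interpolation parameter `φ_k(y)`. -/
def param (φ : ℝ → ℝ) (k : ℕ) (y : ℝ) : ℝ := φ ((y - ySeq (1/3) k) / (1/3) ^ (k + 1))

/-- The function equal to `Q k x (φ_k(y))` for `y ∈ [y_k, y_{k+1})`. -/
def glue (φ : ℝ → ℝ) (Q : ℕ → ℝ → ℝ → ℝ) (x y : ℝ) : ℝ :=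
  Q (level y) x (param φ (level y) y)

lemma param_eventually_zero {φ : ℝ → ℝ} (hφ0 : ∃ ε > 0, ∀ t < ε, φ t = 0) (k : ℕ) :
    ∀ᶠ y in 𝓝 (ySeq (1/3) k), param φ k y = 0 := by
  obtain ⟨ε, hε, h⟩ := hφ0
  have hc : ContinuousAt (fun y => (y - ySeq (1/3) k) / (1/3 : ℝ) ^ (k + 1)) (ySeq (1/3) k) := by
    fun_prop
  filter_upwards [hc.eventually_lt_const (u := ε) (by simpa using hε)] with y hy
  exact h _ hy

lemma param_eventually_one {φ : ℝ → ℝ} (hφ1 : ∃ ε > 0, ∀ t > 1 - ε, φ t = 1) (k : ℕ) :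
    ∀ᶠ y in 𝓝 (ySeq (1/3) (k + 1)), param φ k y = 1 := by
  obtain ⟨ε, hε, h⟩ := hφ1
  have hc : ContinuousAt (fun y => (y - ySeq (1/3) k) / (1/3 : ℝ) ^ (k + 1))
      (ySeq (1/3) (k + 1)) := by
    fun_prop
  have h1 : (ySeq (1/3) (k + 1) - ySeq (1/3) k) / (1/3 : ℝ) ^ (k + 1) = 1 := by
    rw [ySeq_third, ySeq_third]; field_simp; ring
  filter_upwards [hc.eventually_const_lt (u := 1 - ε) (by
      simp only [h1]; linarith)] with y hy
  exact h _ hy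

lemma glue_eventually {φ : ℝ → ℝ} (hφ0 : ∃ ε > 0, ∀ t < ε, φ t = 0)
    (hφ1 : ∃ ε > 0, ∀ t > 1 - ε, φ t = 1) {Q : ℕ → ℝ → ℝ → ℝ}
    (hQ : ∀ k x, Q k x 1 = Q (k + 1) x 0) {y : ℝ} (hy : y < 1/2) :
    ∀ᶠ y' in 𝓝 y, ∀ x, glue φ Q x y' = Q (level y) x (param φ (level y) y') := by
  have key : ∀ k, (∀ᶠ y' in 𝓝 y, level y' = k) → level y = k →
      ∀ᶠ y' in 𝓝 y, ∀ x, glue φ Q x y' = Q (level y) x (param φ (level y) y') := by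
    intro k h hk
    filter_upwards [h] with y' hy' x
    rw [glue, hy', hk]
  have y0 : ySeq (1/3) 0 = 0 := by simp [ySeq]
  rcases lt_or_ge y 0 with h0 | h0
  · exact key 0 ((eventually_lt_nhds h0).mono fun _ => level_of_neg) (level_of_neg h0)
  obtain ⟨k, hk, hk'⟩ := exists_level h0 hy
  have hl := level_eq hk hk'
  rcases hk.lt_or_eq with hlt | rfl
  · refine key k ?_ hl
    filter_upwards [eventually_gt_nhds hlt, eventually_lt_nhds hk'] with y' h1 h2
    exact level_eq h1.le h2
  cases k with
  | zero =>
    refine key 0 ?_ hl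
    filter_upwards [eventually_lt_nhds hk'] with y' h2
    rcases lt_or_ge y' 0 with h3 | h3
    · exact level_of_neg h3
    · exact level_eq (by rwa [y0]) h2
  | succ j =>
    rw [hl]
    filter_upwards [eventually_lt_nhds hk',
      eventually_gt_nhds (ySeq_third_strictMono (Nat.lt_succ_self j)),
      param_eventually_zero hφ0 (j + 1), param_eventually_one hφ1 j] with y' h1 h2 h3 h4 x
    rcases lt_or_ge y' (ySeq (1/3) (j + 1)) with h5 | h5
    · rw [glue, level_eq h2.le h5, h3, h4, hQ]
    · rw [glue, level_eq h5 h1]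

/-- A function of `(k, x, t)` interpolated in `y`, as a function on `ℝ³`. -/
def lift (φ : ℝ → ℝ) (Q : ℕ → ℝ → ℝ → ℝ) (p : ℝ × ℝ × ℝ) : ℝ := glue φ Q p.1 p.2.1

/-- The formula for `lift` on the slab of index `k`. -/
def piece (φ : ℝ → ℝ) (Q : ℕ → ℝ → ℝ → ℝ) (k : ℕ) (p : ℝ × ℝ × ℝ) : ℝ :=
  Q k p.1 (param φ k p.2.1)

lemma lift_eventuallyEq {φ : ℝ → ℝ} (hφ0 : ∃ ε > 0, ∀ t < ε, φ t = 0)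
    (hφ1 : ∃ ε > 0, ∀ t > 1 - ε, φ t = 1) {Q : ℕ → ℝ → ℝ → ℝ}
    (hQ : ∀ k x, Q k x 1 = Q (k + 1) x 0) {p : ℝ × ℝ × ℝ} (hp : p.2.1 < 1/2) :
    lift φ Q =ᶠ[𝓝 p] piece φ Q (level p.2.1) := by
  have hc : ContinuousAt (fun q : ℝ × ℝ × ℝ => q.2.1) p := by fun_prop
  filter_upwards [hc.eventually (glue_eventually hφ0 hφ1 hQ hp)] with q hq
  exact hq _

lemma contDiff_piece {φ : ℝ → ℝ} (hφ : ContDiff ℝ (⊤ : ℕ∞) φ) {Q : ℕ → ℝ → ℝ → ℝ}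
    {k : ℕ} (hQ : ContDiff ℝ (⊤ : ℕ∞) fun r : ℝ × ℝ => Q k r.1 r.2) :
    ContDiff ℝ (⊤ : ℕ∞) (piece φ Q k) := by
  have h : ContDiff ℝ (⊤ : ℕ∞) fun p : ℝ × ℝ × ℝ => (p.1, param φ k p.2.1) := by
    unfold param; fun_prop
  exact hQ.comp h

/-! ### The coefficients of the form -/

/-- The oscillating part of the primitive, in the rescaled variable `A = 4^k x`. -/
def osc (A t : ℝ) : ℝ :=
  (1 - 3 * t ^ 2 + 2 * t ^ 3) * (sin (2 * A) / 2) + (3 * t ^ 2 - 2 * t ^ 3) * (sin (8 * A) / 8)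
    + (4/3 * (t + t ^ 2 - 2 * t ^ 3) + 3/4 * (3 * t - 5 * t ^ 2 + 2 * t ^ 3))
      * (sin (3 * A) / 3 + sin (5 * A) / 5)

/-- The derivative of `osc` in the interpolation parameter. -/
def oscDeriv (A t : ℝ) : ℝ :=
  (-6 * t + 6 * t ^ 2) * (sin (2 * A) / 2) + (6 * t - 6 * t ^ 2) * (sin (8 * A) / 8)
    + (4/3 * (1 + 2 * t - 6 * t ^ 2) + 3/4 * (3 - 10 * t + 6 * t ^ 2))
      * (sin (3 * A) / 3 + sin (5 * A) / 5)

/-- The rescaled vertical coefficient. -/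
def vert (A t : ℝ) : ℝ :=
  (1 + t - 2 * t ^ 2) * cos A + (3 * t - 2 * t ^ 2) * (3/4 * cos (4 * A))

/-- The rescaled slope of `ψ`. -/
def slope (A t : ℝ) : ℝ := (1 - t) * cos A + t * (4/3 * cos (4 * A))

/-- The primitive of the form on the graph. -/
def primQ (S : ℝ → ℝ) (k : ℕ) (x t : ℝ) : ℝ :=
  S x + deriv S x * ((1/4) ^ k * osc (4 ^ k * x) t)

/-- The coefficient of `dz - dψ`. -/
def vertQ (S : ℝ → ℝ) (k : ℕ) (x t : ℝ) : ℝ :=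
  2 * deriv S x * ((3/4) ^ k * vert (4 ^ k * x) t)

/-- The interpolation defining `ψ`. -/
def psiQ (k : ℕ) (x t : ℝ) : ℝ :=
  (1 - t) * fSeq (1/3) (1/4) k x + t * fSeq (1/3) (1/4) (k + 1) x

lemma primQ_compat (S : ℝ → ℝ) (k : ℕ) (x : ℝ) : primQ S k x 1 = primQ S (k + 1) x 0 := by
  have : 8 * (4 ^ k * x) = 2 * (4 ^ (k + 1) * x) := by ring
  simp only [primQ, osc, this]; ring

lemma vertQ_compat (S : ℝ → ℝ) (k : ℕ) (x : ℝ) : vertQ S k x 1 = vertQ S (k + 1) x 0 := by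
  have : 4 * (4 ^ k * x) = 4 ^ (k + 1) * x := by ring
  simp only [vertQ, vert, this]; ring

lemma psiQ_compat (k : ℕ) (x : ℝ) : psiQ k x 1 = psiQ (k + 1) x 0 := by
  simp only [psiQ]; ring

lemma fSeq_contDiff (k : ℕ) : ContDiff ℝ (⊤ : ℕ∞) (fSeq (1/3) (1/4) k) := by
  unfold fSeq
  split_ifs
  · exact contDiff_const
  · fun_prop

lemma contDiff_deriv_infty {S : ℝ → ℝ} (hS : ContDiff ℝ (⊤ : ℕ∞) S) :
    ContDiff ℝ (⊤ : ℕ∞) (deriv S) := (contDiff_infty_iff_deriv.1 hS).2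

lemma primQ_contDiff {S : ℝ → ℝ} (hS : ContDiff ℝ (⊤ : ℕ∞) S) (k : ℕ) :
    ContDiff ℝ (⊤ : ℕ∞) fun r : ℝ × ℝ => primQ S k r.1 r.2 := by
  have := contDiff_deriv_infty hS
  unfold primQ osc
  fun_prop

lemma vertQ_contDiff {S : ℝ → ℝ} (hS : ContDiff ℝ (⊤ : ℕ∞) S) (k : ℕ) :
    ContDiff ℝ (⊤ : ℕ∞) fun r : ℝ × ℝ => vertQ S k r.1 r.2 := by
  have := contDiff_deriv_infty hS
  unfold vertQ vert
  fun_prop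

lemma psiQ_contDiff (k : ℕ) : ContDiff ℝ (⊤ : ℕ∞) fun r : ℝ × ℝ => psiQ k r.1 r.2 := by
  have := fSeq_contDiff k
  have := fSeq_contDiff (k + 1)
  unfold psiQ
  fun_prop

lemma psi_eq_glue (φ : ℝ → ℝ) (x : ℝ) {y : ℝ} (h0 : 0 ≤ y) (h1 : y < 1/2) :
    psi (1/3) (1/3) (1/4) φ x y = glue φ psiQ x y := by
  have hk := exists_level h0 h1
  simp only [psi, glue, level, dif_pos hk, psiQ, param]

/-! ### Estimates -/

lemma osc_hasDerivAt_left (A t : ℝ) :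
    HasDerivAt (fun A => osc A t) (2 * vert A t * slope A t - 1) A := by
  have hs : ∀ c : ℝ, HasDerivAt (fun A : ℝ => sin (c * A)) (cos (c * A) * c) A := fun c => by
    simpa using ((hasDerivAt_id A).const_mul c).sin
  have h := ((((hs 2).div_const 2).const_mul (1 - 3 * t ^ 2 + 2 * t ^ 3)).add
    (((hs 8).div_const 8).const_mul (3 * t ^ 2 - 2 * t ^ 3))).add
    ((((hs 3).div_const 3).add ((hs 5).div_const 5)).const_mul
      (4/3 * (t + t ^ 2 - 2 * t ^ 3) + 3/4 * (3 * t - 5 * t ^ 2 + 2 * t ^ 3)))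
  refine h.congr_deriv ?_
  have e2 : cos (2 * A) = 2 * cos A ^ 2 - 1 := cos_two_mul A
  have e8 : cos (8 * A) = 2 * cos (4 * A) ^ 2 - 1 := by rw [← cos_two_mul]; ring_nf
  have e3 : cos (3 * A) = cos (4 * A) * cos A + sin (4 * A) * sin A := by
    rw [← cos_sub]; ring_nf
  have e5 : cos (5 * A) = cos (4 * A) * cos A - sin (4 * A) * sin A := by
    rw [← cos_add]; ring_nf
  rw [e2, e8, e3, e5, vert, slope]
  ring

lemma osc_hasDerivAt_right (A t : ℝ) : HasDerivAt (fun t => osc A t) (oscDeriv A t) t := by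
  have h1 : HasDerivAt (fun t : ℝ => t) 1 t := hasDerivAt_id t
  have h2 : HasDerivAt (fun t : ℝ => t ^ 2) (2 * t) t := by simpa using hasDerivAt_pow 2 t
  have h3 : HasDerivAt (fun t : ℝ => t ^ 3) (3 * t ^ 2) t := by simpa using hasDerivAt_pow 3 t
  have h := (((((h2.const_mul 3).const_sub 1).add (h3.const_mul 2)).mul_const (sin (2 * A) / 2)).add
    (((h2.const_mul 3).sub (h3.const_mul 2)).mul_const (sin (8 * A) / 8))).add
    (((((h1.add h2).sub (h3.const_mul 2)).const_mul (4/3)).add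
      ((((h1.const_mul 3).sub (h2.const_mul 5)).add (h3.const_mul 2)).const_mul (3/4))).mul_const
      (sin (3 * A) / 3 + sin (5 * A) / 5))
  refine h.congr_deriv ?_
  rw [oscDeriv]; ring

lemma abs_three_mul_le {a b c A B C u v w : ℝ} (ha : |a| ≤ A) (hb : |b| ≤ B) (hc : |c| ≤ C)
    (hu : |u| ≤ 1) (hv : |v| ≤ 1) (hw : |w| ≤ 1) :
    |a * u + b * v + c * w| ≤ A + B + C := by
  have h : ∀ {a A u : ℝ}, |a| ≤ A → |u| ≤ 1 → |a * u| ≤ A := fun {a A u} ha hu => by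
    rw [abs_mul]
    exact (mul_le_of_le_one_right (abs_nonneg a) hu).trans ha
  exact (abs_add_three _ _ _).trans (add_le_add_three (h ha hu) (h hb hv) (h hc hw))

lemma abs_sin_div_le (x : ℝ) {n : ℝ} (hn : 1 ≤ n) : |sin x / n| ≤ 1 / n := by
  rw [abs_div, abs_of_pos (by linarith : (0:ℝ) < n)]
  gcongr
  exact abs_sin_le_one x

lemma abs_sin_combo_le (x y : ℝ) : |sin x / 3 + sin y / 5| ≤ 1 := by
  have h1 := abs_sin_div_le x (n := 3) (by norm_num)
  have h2 := abs_sin_div_le y (n := 5) (by norm_num)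
  exact (abs_add_le _ _).trans (by linarith)

lemma abs_osc_le (A : ℝ) {t : ℝ} (ht : t ∈ Icc (0:ℝ) 1) : |osc A t| ≤ 60 := by
  obtain ⟨h0, h1⟩ := ht
  have h2 : 0 ≤ t ^ 2 := by positivity
  have h2' : t ^ 2 ≤ 1 := pow_le_one₀ h0 h1
  have h3 : 0 ≤ t ^ 3 := by positivity
  have h3' : t ^ 3 ≤ 1 := pow_le_one₀ h0 h1
  have := abs_three_mul_le (A := 20) (B := 20) (C := 20)
    (a := 1 - 3 * t ^ 2 + 2 * t ^ 3) (b := 3 * t ^ 2 - 2 * t ^ 3)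
    (c := 4/3 * (t + t ^ 2 - 2 * t ^ 3) + 3/4 * (3 * t - 5 * t ^ 2 + 2 * t ^ 3))
    (by rw [abs_le]; constructor <;> linarith)
    (by rw [abs_le]; constructor <;> linarith) (by rw [abs_le]; constructor <;> linarith)
    ((abs_sin_div_le (2 * A) (n := 2) (by norm_num)).trans (by norm_num))
    ((abs_sin_div_le (8 * A) (n := 8) (by norm_num)).trans (by norm_num))
    (abs_sin_combo_le (3 * A) (5 * A))
  exact this.trans (by norm_num)

lemma abs_oscDeriv_le (A : ℝ) {t : ℝ} (ht : t ∈ Icc (0:ℝ) 1) : |oscDeriv A t| ≤ 60 := by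
  obtain ⟨h0, h1⟩ := ht
  have h2 : 0 ≤ t ^ 2 := by positivity
  have h2' : t ^ 2 ≤ 1 := pow_le_one₀ h0 h1
  have := abs_three_mul_le (A := 20) (B := 20) (C := 20)
    (a := -6 * t + 6 * t ^ 2) (b := 6 * t - 6 * t ^ 2)
    (c := 4/3 * (1 + 2 * t - 6 * t ^ 2) + 3/4 * (3 - 10 * t + 6 * t ^ 2))
    (by rw [abs_le]; constructor <;> linarith)
    (by rw [abs_le]; constructor <;> linarith) (by rw [abs_le]; constructor <;> linarith)
    ((abs_sin_div_le (2 * A) (n := 2) (by norm_num)).trans (by norm_num))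
    ((abs_sin_div_le (8 * A) (n := 8) (by norm_num)).trans (by norm_num))
    (abs_sin_combo_le (3 * A) (5 * A))
  exact this.trans (by norm_num)

lemma abs_vert_le (A : ℝ) {t : ℝ} (ht : t ∈ Icc (0:ℝ) 1) : |vert A t| ≤ 10 := by
  obtain ⟨h0, h1⟩ := ht
  have h2 : 0 ≤ t ^ 2 := by positivity
  have h2' : t ^ 2 ≤ 1 := pow_le_one₀ h0 h1
  have := abs_three_mul_le (A := 5) (B := 5) (C := 0) (a := 1 + t - 2 * t ^ 2)
    (b := 3 * t - 2 * t ^ 2) (c := 0) (w := 0) (u := cos A) (v := 3/4 * cos (4 * A))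
    (by rw [abs_le]; constructor <;> linarith)
    (by rw [abs_le]; constructor <;> linarith) (by simp) (abs_cos_le_one A)
    (by
      have := abs_le.1 (abs_cos_le_one (4 * A))
      rw [abs_le]; constructor <;> linarith) (by simp)
  rw [vert]
  norm_num at this
  exact this

lemma abs_fSeq_le (k : ℕ) (x : ℝ) : |fSeq (1/3) (1/4) k x| ≤ (1/3) ^ k := by
  unfold fSeq
  split_ifs
  · simp
  · rw [abs_mul, abs_of_nonneg (by positivity : (0:ℝ) ≤ (1/3) ^ k)]
    exact mul_le_of_le_one_right (by positivity) (abs_sin_le_one _)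

lemma abs_fSeq_le_third (k : ℕ) (x : ℝ) : |fSeq (1/3) (1/4) k x| ≤ 1/3 := by
  rcases k with _ | k
  · simp [fSeq]
  · refine (abs_fSeq_le _ x).trans ?_
    rw [pow_succ]
    exact mul_le_of_le_one_left (by norm_num) (pow_le_one₀ (by norm_num) (by norm_num))

lemma abs_psiQ_le (k : ℕ) (x : ℝ) {t : ℝ} (ht : t ∈ Icc (0:ℝ) 1) : |psiQ k x t| ≤ 1/3 := by
  obtain ⟨h0, h1⟩ := ht
  have h2 := abs_le.1 (abs_fSeq_le_third k x)
  have h3 := abs_le.1 (abs_fSeq_le_third (k + 1) x)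
  rw [psiQ, abs_le]
  constructor <;> nlinarith

lemma fSeq_hasDerivAt {k : ℕ} (hk : k ≠ 0) (x : ℝ) :
    HasDerivAt (fSeq (1/3) (1/4) k) ((4/3) ^ k * cos (4 ^ k * x)) x := by
  have e : fSeq (1/3) (1/4) k = fun x => (1/3) ^ k * sin (4 ^ k * x) := by
    funext x
    rw [fSeq, if_neg hk, one_div 4, inv_pow, div_inv_eq_mul, mul_comm x]
  rw [e]
  have h := (((hasDerivAt_id x).const_mul ((4:ℝ) ^ k)).sin).const_mul (((1:ℝ)/3) ^ k)
  refine h.congr_deriv ?_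
  simp only [id]
  rw [show (4/3 : ℝ) = 1/3 * 4 by norm_num, mul_pow]
  ring

lemma psiQ_hasDerivAt_left {k : ℕ} (hk : k ≠ 0) (x t : ℝ) :
    HasDerivAt (fun x => psiQ k x t) ((4/3) ^ k * slope (4 ^ k * x) t) x := by
  have h := ((fSeq_hasDerivAt hk x).const_mul (1 - t)).add
    ((fSeq_hasDerivAt k.succ_ne_zero x).const_mul t)
  refine h.congr_deriv ?_
  rw [slope, Nat.succ_eq_add_one, show (4:ℝ) ^ (k + 1) * x = 4 * (4 ^ k * x) by ring]
  ring

lemma psiQ_hasDerivAt_right (k : ℕ) (x t : ℝ) :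
    HasDerivAt (fun t => psiQ k x t) (fSeq (1/3) (1/4) (k + 1) x - fSeq (1/3) (1/4) k x) t := by
  have h := (((hasDerivAt_id t).const_sub 1).mul_const (fSeq (1/3) (1/4) k x)).add
    ((hasDerivAt_id t).mul_const (fSeq (1/3) (1/4) (k + 1) x))
  refine h.congr_deriv ?_
  ring

lemma primQ_hasDerivAt_left {S : ℝ → ℝ} (hS : ContDiff ℝ (⊤ : ℕ∞) S) (k : ℕ) (x t : ℝ) :
    HasDerivAt (fun x => primQ S k x t) (deriv S x
      + (deriv (deriv S) x * ((1/4) ^ k * osc (4 ^ k * x) t)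
        + deriv S x * (2 * vert (4 ^ k * x) t * slope (4 ^ k * x) t - 1))) x := by
  have h1 : HasDerivAt S (deriv S x) x := (hS.differentiable (by simp) x).hasDerivAt
  have h2 : HasDerivAt (deriv S) (deriv (deriv S) x) x :=
    ((contDiff_deriv_infty hS).differentiable (by simp) x).hasDerivAt
  have h3 : HasDerivAt (fun x : ℝ => 4 ^ k * x) (4 ^ k) x := by
    simpa using (hasDerivAt_id x).const_mul ((4:ℝ) ^ k)
  have h4 := ((osc_hasDerivAt_left (4 ^ k * x) t).comp x h3).const_mul ((1/4 : ℝ) ^ k)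
  have h := h1.add (h2.mul h4)
  refine h.congr_deriv ?_
  have : (1/4 : ℝ) ^ k * 4 ^ k = 1 := by rw [← mul_pow]; norm_num
  simp only [Function.comp]
  linear_combination (deriv S x * (2 * vert (4 ^ k * x) t * slope (4 ^ k * x) t - 1)) * this

lemma primQ_hasDerivAt_right (S : ℝ → ℝ) (k : ℕ) (x t : ℝ) :
    HasDerivAt (fun t => primQ S k x t)
      (deriv S x * ((1/4) ^ k * oscDeriv (4 ^ k * x) t)) t :=
  (((osc_hasDerivAt_right (4 ^ k * x) t).const_mul _).const_mul _).const_add _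

lemma param_hasDerivAt {φ : ℝ → ℝ} (hφ : Differentiable ℝ φ) (k : ℕ) (y : ℝ) :
    HasDerivAt (param φ k)
      (deriv φ ((y - ySeq (1/3) k) / (1/3) ^ (k + 1)) * 3 ^ (k + 1)) y := by
  have h1 : HasDerivAt (fun y => (y - ySeq (1/3) k) / (1/3 : ℝ) ^ (k + 1)) (3 ^ (k + 1)) y := by
    have := ((hasDerivAt_id y).sub_const (ySeq (1/3) k)).div_const ((1/3 : ℝ) ^ (k + 1))
    refine this.congr_deriv ?_
    rw [one_div 3, inv_pow, one_div, inv_inv]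
  exact (hφ _).hasDerivAt.comp y h1

/-! ### The form -/

/-- The covector `dz`. -/
def dz : ℝ × ℝ × ℝ →L[ℝ] ℝ :=
  (ContinuousLinearMap.snd ℝ ℝ ℝ).comp (ContinuousLinearMap.snd ℝ ℝ (ℝ × ℝ))

/-- The form `dF + g (dz - dψ)`. -/
def preform (F g ψ : ℝ × ℝ × ℝ → ℝ) (p : ℝ × ℝ × ℝ) : ℝ × ℝ × ℝ →L[ℝ] ℝ :=
  fderiv ℝ F p + g p • (dz - fderiv ℝ ψ p)

lemma preform_eventuallyEq {F g ψ F' g' ψ' : ℝ × ℝ × ℝ → ℝ} {p : ℝ × ℝ × ℝ}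
    (hF : F =ᶠ[𝓝 p] F') (hg : g =ᶠ[𝓝 p] g') (hψ : ψ =ᶠ[𝓝 p] ψ') :
    preform F g ψ =ᶠ[𝓝 p] preform F' g' ψ' := by
  filter_upwards [hF.fderiv (𝕜 := ℝ), hg, hψ.fderiv (𝕜 := ℝ)] with q h1 h2 h3
  rw [preform, preform, h1, h2, h3]

lemma contDiffAt_preform {F g ψ : ℝ × ℝ × ℝ → ℝ} {p : ℝ × ℝ × ℝ} (hF : ContDiffAt ℝ 2 F p)
    (hg : ContDiffAt ℝ 1 g p) (hψ : ContDiffAt ℝ 2 ψ p) : ContDiffAt ℝ 1 (preform F g ψ) p := by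
  have h1 : ContDiffAt ℝ 1 (fderiv ℝ F) p := hF.fderiv_right (by norm_num)
  have h2 : ContDiffAt ℝ 1 (fderiv ℝ ψ) p := hψ.fderiv_right (by norm_num)
  exact h1.add (hg.smul (contDiffAt_const.sub h2))

lemma fderiv_preform_symm {F g ψ : ℝ × ℝ × ℝ → ℝ} {p u v : ℝ × ℝ × ℝ}
    (hF : ContDiffAt ℝ 2 F p) (hg : ContDiffAt ℝ 1 g p) (hψ : ContDiffAt ℝ 2 ψ p)
    (hu : (dz - fderiv ℝ ψ p) u = 0) (hv : (dz - fderiv ℝ ψ p) v = 0) :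
    fderiv ℝ (preform F g ψ) p u v = fderiv ℝ (preform F g ψ) p v u := by
  have h1 : HasFDerivAt (fderiv ℝ F) (fderiv ℝ (fderiv ℝ F) p) p :=
    ((hF.fderiv_right (m := 1) (by norm_num)).differentiableAt (by simp)).hasFDerivAt
  have h2 : HasFDerivAt (fderiv ℝ ψ) (fderiv ℝ (fderiv ℝ ψ) p) p :=
    ((hψ.fderiv_right (m := 1) (by norm_num)).differentiableAt (by simp)).hasFDerivAt
  have h3 : HasFDerivAt g (fderiv ℝ g p) p := (hg.differentiableAt (by simp)).hasFDerivAt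
  have h := h1.add (h3.smul ((hasFDerivAt_const dz p).sub h2))
  have e1 := (hF.isSymmSndFDerivAt (by simp)).eq u v
  have e2 := (hψ.isSymmSndFDerivAt (by simp)).eq u v
  have h' : HasFDerivAt (preform F g ψ) _ p := h
  rw [h'.fderiv]
  simp only [sub_apply] at hu hv
  simp [hu, hv, e1, e2]

lemma norm_le_basis (L : ℝ × ℝ × ℝ →L[ℝ] ℝ) :
    ‖L‖ ≤ |L (1, 0, 0)| + |L (0, 1, 0)| + |L (0, 0, 1)| := by
  refine L.opNorm_le_bound (by positivity) fun v => ?_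
  obtain ⟨a, b, c⟩ := v
  have e : ((a, b, c) : ℝ × ℝ × ℝ) = a • (1, 0, 0) + b • (0, 1, 0) + c • (0, 0, 1) := by simp
  have ha : |a| ≤ ‖((a, b, c) : ℝ × ℝ × ℝ)‖ := norm_fst_le (a, b, c)
  have hbc : ‖(b, c)‖ ≤ ‖((a, b, c) : ℝ × ℝ × ℝ)‖ := norm_snd_le (a, b, c)
  have hb : |b| ≤ ‖((a, b, c) : ℝ × ℝ × ℝ)‖ := (norm_fst_le (b, c)).trans hbc
  have hc : |c| ≤ ‖((a, b, c) : ℝ × ℝ × ℝ)‖ := (norm_snd_le (b, c)).trans hbc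
  have hL : L (a, b, c) = a * L (1, 0, 0) + b * L (0, 1, 0) + c * L (0, 0, 1) := by
    conv_lhs => rw [e]
    simp only [map_add, map_smul, smul_eq_mul]
  rw [Real.norm_eq_abs, hL]
  refine (abs_add_three _ _ _).trans ?_
  rw [abs_mul, abs_mul, abs_mul, add_mul, add_mul, mul_comm |a|, mul_comm |b|, mul_comm |c|]
  gcongr

lemma fderiv_apply_e1 {f : ℝ × ℝ × ℝ → ℝ} {x y z : ℝ} (hf : DifferentiableAt ℝ f (x, y, z)) :
    HasDerivAt (fun s => f (s, y, z)) (fderiv ℝ f (x, y, z) (1, 0, 0)) x :=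
  hf.hasFDerivAt.comp_hasDerivAt (f := fun s => (s, y, z)) x
    ((hasDerivAt_id x).prodMk (hasDerivAt_const x (y, z)))

lemma fderiv_apply_e2 {f : ℝ × ℝ × ℝ → ℝ} {x y z : ℝ} (hf : DifferentiableAt ℝ f (x, y, z)) :
    HasDerivAt (fun s => f (x, s, z)) (fderiv ℝ f (x, y, z) (0, 1, 0)) y :=
  hf.hasFDerivAt.comp_hasDerivAt (f := fun s => (x, s, z)) y
    ((hasDerivAt_const y x).prodMk ((hasDerivAt_id y).prodMk (hasDerivAt_const y z)))

lemma fderiv_apply_e3 {f : ℝ × ℝ × ℝ → ℝ} {x y z : ℝ} (hf : DifferentiableAt ℝ f (x, y, z)) :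
    HasDerivAt (fun s => f (x, y, s)) (fderiv ℝ f (x, y, z) (0, 0, 1)) z :=
  hf.hasFDerivAt.comp_hasDerivAt (f := fun s => (x, y, s)) z
    ((hasDerivAt_const z x).prodMk ((hasDerivAt_const z y).prodMk (hasDerivAt_id z)))

lemma norm_preform_piece_le {φ S : ℝ → ℝ} (hφ : ContDiff ℝ (⊤ : ℕ∞) φ)
    (hφ01 : ∀ t, φ t ∈ Icc (0:ℝ) 1) (hφd0 : ∀ t, 0 ≤ deriv φ t) (hφd2 : ∀ t, deriv φ t ≤ 2)
    (hS : ContDiff ℝ (⊤ : ℕ∞) S) {C : ℝ} (hC1 : ∀ x, |deriv S x| ≤ C)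
    (hC2 : ∀ x, |deriv (deriv S) x| ≤ C) {k : ℕ} (hk : k ≠ 0) (p : ℝ × ℝ × ℝ) :
    ‖preform (piece φ (primQ S) k) (piece φ (vertQ S) k) (piece φ psiQ k) p‖
      ≤ C * 1000 * (3/4) ^ k := by
  obtain ⟨x, y, z⟩ := p
  have dF : DifferentiableAt ℝ (piece φ (primQ S) k) (x, y, z) :=
    (contDiff_piece hφ (primQ_contDiff hS k)).differentiable (by simp) _
  have dψ : DifferentiableAt ℝ (piece φ psiQ k) (x, y, z) :=
    (contDiff_piece hφ (psiQ_contDiff k)).differentiable (by simp) _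
  have hp := param_hasDerivAt (hφ.differentiable (by simp)) k y
  set t := param φ k y
  set d := deriv φ ((y - ySeq (1/3) k) / (1/3) ^ (k + 1))
  have ht01 : t ∈ Icc (0:ℝ) 1 := hφ01 _
  have F1 := (fderiv_apply_e1 dF).unique (primQ_hasDerivAt_left hS k x t)
  have F2 := (fderiv_apply_e2 dF).unique (HasDerivAt.comp (h₂ := primQ S k x) y (primQ_hasDerivAt_right S k x t) hp)
  have F3 := (fderiv_apply_e3 dF).unique (hasDerivAt_const z (primQ S k x t))
  have P1 := (fderiv_apply_e1 dψ).unique (psiQ_hasDerivAt_left hk x t)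
  have P2 := (fderiv_apply_e2 dψ).unique (HasDerivAt.comp (h₂ := psiQ k x) y (psiQ_hasDerivAt_right k x t) hp)
  have P3 := (fderiv_apply_e3 dψ).unique (hasDerivAt_const z (psiQ k x t))
  have hg : piece φ (vertQ S) k (x, y, z) = 2 * deriv S x * ((3/4) ^ k * vert (4 ^ k * x) t) := rfl
  have hC0 : 0 ≤ C := (abs_nonneg _).trans (hC1 0)
  have hd2 : |d| ≤ 2 := by rw [abs_of_nonneg (hφd0 _)]; exact hφd2 _
  have hU := abs_osc_le (4 ^ k * x) ht01
  have hU' := abs_oscDeriv_le (4 ^ k * x) ht01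
  have hW := abs_vert_le (4 ^ k * x) ht01
  have hf1 := abs_fSeq_le k x
  have hf2 : |fSeq (1/3) (1/4) (k + 1) x| ≤ (1/3) ^ k :=
    (abs_fSeq_le (k + 1) x).trans (pow_le_pow_of_le_one (by norm_num) (by norm_num) (by simp))
  have hff : |fSeq (1/3) (1/4) (k + 1) x - fSeq (1/3) (1/4) k x| ≤ 2 * (1/3) ^ k :=
    (abs_sub _ _).trans (by linarith)
  have q1 : (3/4 : ℝ) ^ k * (4/3) ^ k = 1 := by rw [← mul_pow]; norm_num
  have q2 : (1/4 : ℝ) ^ k * 3 ^ k = (3/4) ^ k := by rw [← mul_pow]; norm_num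
  have q3 : (1/3 : ℝ) ^ k * 3 ^ k = 1 := by rw [← mul_pow]; norm_num
  have q4 : (1/4 : ℝ) ^ k ≤ (3/4) ^ k := by gcongr; norm_num
  have z1 : dz (1, 0, 0) = 0 := rfl
  have z2 : dz (0, 1, 0) = 0 := rfl
  have z3 : dz (0, 0, 1) = 1 := rfl
  refine (norm_le_basis _).trans ?_
  simp only [preform, add_apply, smul_apply,
    sub_apply, smul_eq_mul, F1, F2, F3, P1, P2, P3, hg, z1, z2, z3]
  have b1 : |deriv S x + (deriv (deriv S) x * ((1/4) ^ k * osc (4 ^ k * x) t)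
        + deriv S x * (2 * vert (4 ^ k * x) t * slope (4 ^ k * x) t - 1))
      + 2 * deriv S x * ((3/4) ^ k * vert (4 ^ k * x) t)
        * (0 - (4/3) ^ k * slope (4 ^ k * x) t)| ≤ C * ((3/4) ^ k * 60) := by
    have : deriv S x + (deriv (deriv S) x * ((1/4) ^ k * osc (4 ^ k * x) t)
        + deriv S x * (2 * vert (4 ^ k * x) t * slope (4 ^ k * x) t - 1))
      + 2 * deriv S x * ((3/4) ^ k * vert (4 ^ k * x) t)
        * (0 - (4/3) ^ k * slope (4 ^ k * x) t)
        = deriv (deriv S) x * ((1/4) ^ k * osc (4 ^ k * x) t) := by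
      linear_combination
        (-2 * deriv S x * vert (4 ^ k * x) t * slope (4 ^ k * x) t) * q1
    rw [this, abs_mul, abs_mul, abs_of_nonneg (by positivity : (0:ℝ) ≤ (1/4) ^ k)]
    gcongr
    exact hC2 x
  have b2 : |deriv S x * ((1/4) ^ k * oscDeriv (4 ^ k * x) t) * (d * 3 ^ (k + 1))
      + 2 * deriv S x * ((3/4) ^ k * vert (4 ^ k * x) t)
        * (0 - (fSeq (1/3) (1/4) (k + 1) x - fSeq (1/3) (1/4) k x) * (d * 3 ^ (k + 1)))|
      ≤ C * ((3/4) ^ k * 60) * (2 * 3) + 2 * C * ((3/4) ^ k * 10) * (2 * (2 * 3)) := by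
    have : deriv S x * ((1/4) ^ k * oscDeriv (4 ^ k * x) t) * (d * 3 ^ (k + 1))
      + 2 * deriv S x * ((3/4) ^ k * vert (4 ^ k * x) t)
        * (0 - (fSeq (1/3) (1/4) (k + 1) x - fSeq (1/3) (1/4) k x) * (d * 3 ^ (k + 1)))
      = deriv S x * ((3/4) ^ k * oscDeriv (4 ^ k * x) t) * (d * 3)
      - 2 * deriv S x * ((3/4) ^ k * vert (4 ^ k * x) t)
        * ((fSeq (1/3) (1/4) (k + 1) x - fSeq (1/3) (1/4) k x) * 3 ^ k * (d * 3)) := by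
      rw [← q2]; ring
    rw [this]
    refine (abs_sub _ _).trans ?_
    simp only [abs_mul, abs_of_nonneg (by positivity : (0:ℝ) ≤ (3/4) ^ k),
      abs_of_nonneg (by positivity : (0:ℝ) ≤ 3 ^ k), abs_of_nonneg (by norm_num : (0:ℝ) ≤ 3),
      abs_of_nonneg (by norm_num : (0:ℝ) ≤ 2)]
    have hff' : |fSeq (1/3) (1/4) (k + 1) x - fSeq (1/3) (1/4) k x| * 3 ^ k ≤ 2 := by
      refine (mul_le_mul_of_nonneg_right hff (by positivity)).trans ?_
      rw [mul_assoc, q3, mul_one]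
    have := hC1 x
    gcongr
  have b3 : |0 + 2 * deriv S x * ((3/4) ^ k * vert (4 ^ k * x) t) * (1 - 0)|
      ≤ 2 * C * ((3/4) ^ k * 10) := by
    rw [zero_add, sub_zero, mul_one]
    simp only [abs_mul, abs_of_nonneg (by positivity : (0:ℝ) ≤ (3/4) ^ k),
      abs_of_nonneg (by norm_num : (0:ℝ) ≤ 2)]
    have := hC1 x
    gcongr
  have : 0 ≤ C * (3/4) ^ k := by positivity
  linarith

/-- The properties of the transition function used below. -/
structure IsTransition (φ : ℝ → ℝ) : Prop where
  smooth : ContDiff ℝ (⊤ : ℕ∞) φ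
  mem_Icc : ∀ t, φ t ∈ Icc (0:ℝ) 1
  deriv_nonneg : ∀ t, 0 ≤ deriv φ t
  deriv_le : ∀ t, deriv φ t ≤ 2
  eq_zero : ∃ ε > 0, ∀ t < ε, φ t = 0
  eq_one : ∃ ε > 0, ∀ t > 1 - ε, φ t = 1

/-- The transition function rescaled to `[0, π]`. -/
def step (φ : ℝ → ℝ) (x : ℝ) : ℝ := φ (x / π)

lemma step_contDiff {φ : ℝ → ℝ} (h : IsTransition φ) : ContDiff ℝ (⊤ : ℕ∞) (step φ) :=
  h.smooth.comp (contDiff_id.div_const π)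

lemma step_zero {φ : ℝ → ℝ} (h : IsTransition φ) : step φ 0 = 0 := by
  obtain ⟨ε, hε, h0⟩ := h.eq_zero
  exact h0 _ (by simpa using hε)

lemma step_pi {φ : ℝ → ℝ} (h : IsTransition φ) : step φ π = 1 := by
  obtain ⟨ε, hε, h1⟩ := h.eq_one
  refine h1 _ ?_
  rw [div_self pi_ne_zero]
  linarith

lemma step_eventually_const {φ : ℝ → ℝ} (h : IsTransition φ) {x : ℝ} (hx : x ∉ Ioo 0 π) :
    ∃ c, ∀ᶠ x' in 𝓝 x, step φ x' = c := by
  have hc : ContinuousAt (fun x => x / π) x := by fun_prop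
  rcases le_or_gt x 0 with h0 | h0
  · obtain ⟨ε, hε, he⟩ := h.eq_zero
    have : x / π < ε := (div_nonpos_of_nonpos_of_nonneg h0 pi_pos.le).trans_lt hε
    exact ⟨0, (hc.eventually_lt_const this).mono fun _ => he _⟩
  · have h1 : π ≤ x := le_of_not_gt fun h2 => hx ⟨h0, h2⟩
    obtain ⟨ε, hε, he⟩ := h.eq_one
    have : 1 - ε < x / π := (by linarith : 1 - ε < 1).trans_le ((one_le_div pi_pos).2 h1)
    exact ⟨1, (hc.eventually_const_lt this).mono fun _ => he _⟩

lemma deriv_step_eq_zero {φ : ℝ → ℝ} (h : IsTransition φ) {x : ℝ} (hx : x ∉ Ioo 0 π) :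
    deriv (step φ) =ᶠ[𝓝 x] 0 := by
  obtain ⟨c, hc⟩ := step_eventually_const h hx
  have h2 : step φ =ᶠ[𝓝 x] fun _ => c := hc
  refine h2.deriv.trans ?_
  simp only [deriv_const']
  rfl

lemma exists_bound_of_eq_zero {f : ℝ → ℝ} (hf : Continuous f) {a b : ℝ}
    (h : ∀ x ∉ Ioo a b, f x = 0) : ∃ C, ∀ x, |f x| ≤ C := by
  obtain ⟨C, hC⟩ := (isCompact_Icc (a := a) (b := b)).exists_bound_of_continuousOn hf.continuousOn
  refine ⟨max C 0, fun x => ?_⟩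
  by_cases hx : x ∈ Ioo a b
  · exact (hC x (Ioo_subset_Icc_self hx)).trans (le_max_left _ _)
  · simp [h x hx]

lemma exists_bound_step {φ : ℝ → ℝ} (h : IsTransition φ) :
    ∃ C, (∀ x, |deriv (step φ) x| ≤ C) ∧ ∀ x, |deriv (deriv (step φ)) x| ≤ C := by
  have h1 := contDiff_deriv_infty (step_contDiff h)
  obtain ⟨C, hC⟩ := exists_bound_of_eq_zero h1.continuous
    fun x hx => (deriv_step_eq_zero h hx).eq_of_nhds
  obtain ⟨D, hD⟩ := exists_bound_of_eq_zero (contDiff_deriv_infty h1).continuous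
    fun x hx => (deriv_step_eq_zero h hx).deriv.eq_of_nhds.trans (by simp [Pi.zero_def])
  exact ⟨max C D, fun x => (hC x).trans (le_max_left _ _), fun x => (hD x).trans (le_max_right _ _)⟩

/-- The vertical cutoff. -/
def cutoff : ContDiffBump (0 : ℝ) := ⟨1/2, 1, by norm_num, by norm_num⟩

lemma cutoff_eq_one {z : ℝ} (hz : |z| ≤ 1/2) : cutoff z = 1 :=
  cutoff.one_of_mem_closedBall (by simpa [cutoff] using hz)

lemma cutoff_eq_zero {z : ℝ} (hz : 1 ≤ |z|) : cutoff z = 0 :=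
  cutoff.zero_of_le_dist (by simpa [cutoff] using hz)

/-- The form before cutting off vertically. -/
def rawForm (φ : ℝ → ℝ) : ℝ × ℝ × ℝ → (ℝ × ℝ × ℝ →L[ℝ] ℝ) :=
  preform (lift φ (primQ (step φ))) (lift φ (vertQ (step φ))) (lift φ psiQ)

/-- The counterexample to Stokes' theorem. -/
def form (φ : ℝ → ℝ) (p : ℝ × ℝ × ℝ) : ℝ × ℝ × ℝ →L[ℝ] ℝ :=
  if p.2.1 < 1/2 then cutoff p.2.2 • rawForm φ p else 0

lemma contDiffAt_lift {φ : ℝ → ℝ} (h : IsTransition φ) {Q : ℕ → ℝ → ℝ → ℝ}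
    (hQ : ∀ k x, Q k x 1 = Q (k + 1) x 0)
    (hQ' : ∀ k, ContDiff ℝ (⊤ : ℕ∞) fun r : ℝ × ℝ => Q k r.1 r.2) {p : ℝ × ℝ × ℝ}
    (hp : p.2.1 < 1/2) (n : ℕ) : ContDiffAt ℝ n (lift φ Q) p :=
  ((contDiff_piece h.smooth (hQ' _)).contDiffAt.of_le
    (by exact_mod_cast le_top)).congr_of_eventuallyEq
    (lift_eventuallyEq h.eq_zero h.eq_one hQ hp)

lemma contDiffAt_primLift {φ : ℝ → ℝ} (h : IsTransition φ) {p : ℝ × ℝ × ℝ} (hp : p.2.1 < 1/2) :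
    ContDiffAt ℝ 2 (lift φ (primQ (step φ))) p :=
  contDiffAt_lift h (primQ_compat _) (primQ_contDiff (step_contDiff h)) hp 2

lemma contDiffAt_vertLift {φ : ℝ → ℝ} (h : IsTransition φ) {p : ℝ × ℝ × ℝ} (hp : p.2.1 < 1/2) :
    ContDiffAt ℝ 1 (lift φ (vertQ (step φ))) p := by
  simpa using contDiffAt_lift h (vertQ_compat _) (vertQ_contDiff (step_contDiff h)) hp 1

lemma contDiffAt_psiLift {φ : ℝ → ℝ} (h : IsTransition φ) {p : ℝ × ℝ × ℝ} (hp : p.2.1 < 1/2) :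
    ContDiffAt ℝ 2 (lift φ psiQ) p :=
  contDiffAt_lift h psiQ_compat psiQ_contDiff hp 2

lemma eventually_lt_half {p : ℝ × ℝ × ℝ} (hp : p.2.1 < 1/2) : ∀ᶠ q in 𝓝 p, q.2.1 < 1/2 := by
  have hc : ContinuousAt (fun q : ℝ × ℝ × ℝ => q.2.1) p := by fun_prop
  exact hc.eventually_lt_const hp

lemma contDiffAt_form {φ : ℝ → ℝ} (h : IsTransition φ) {p : ℝ × ℝ × ℝ} (hp : p.2.1 < 1/2) :
    ContDiffAt ℝ 1 (form φ) p := by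
  have h1 : ContDiffAt ℝ 1 (rawForm φ) p := contDiffAt_preform (contDiffAt_primLift h hp)
    (contDiffAt_vertLift h hp) (contDiffAt_psiLift h hp)
  have h2 : ContDiff ℝ 1 fun q : ℝ × ℝ × ℝ => cutoff q.2.2 :=
    cutoff.contDiff.comp (contDiff_snd.comp contDiff_snd)
  refine (h2.contDiffAt.smul h1).congr_of_eventuallyEq ?_
  filter_upwards [eventually_lt_half hp] with q hq
  rw [form, if_pos hq]
  rfl

lemma rawForm_eq_zero {φ : ℝ → ℝ} (h : IsTransition φ) {p : ℝ × ℝ × ℝ} (hp : p.1 ∉ Ioo 0 π) :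
    rawForm φ p = 0 := by
  obtain ⟨c, hc⟩ := step_eventually_const h hp
  have hd := deriv_step_eq_zero h hp
  have hcont : ContinuousAt (fun q : ℝ × ℝ × ℝ => q.1) p := by fun_prop
  have h1 : lift φ (primQ (step φ)) =ᶠ[𝓝 p] fun _ => c := by
    filter_upwards [hcont.eventually hc, hcont.eventually hd] with q hq hq'
    simp [lift, glue, primQ, hq, hq']
  have h2 : lift φ (vertQ (step φ)) p = 0 := by
    simp [lift, glue, vertQ, hd.eq_of_nhds]
  rw [rawForm, preform, h1.fderiv_eq, h2]
  simp

lemma form_eq_zero {φ : ℝ → ℝ} (h : IsTransition φ) {p : ℝ × ℝ × ℝ} (hp : p.1 ∉ Ioo 0 π) :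
    form φ p = 0 := by
  rw [form, rawForm_eq_zero h hp]
  simp

lemma form_eq_zero_of_le {φ : ℝ → ℝ} {p : ℝ × ℝ × ℝ} (hp : 1/2 ≤ p.2.1) : form φ p = 0 :=
  if_neg hp.not_gt

lemma form_eq_zero_of_one_le {φ : ℝ → ℝ} {p : ℝ × ℝ × ℝ} (hp : 1 ≤ |p.2.2|) : form φ p = 0 := by
  simp [form, cutoff_eq_zero hp]

lemma exists_norm_form_le {φ : ℝ → ℝ} (h : IsTransition φ) :
    ∃ C, 0 ≤ C ∧ ∀ p : ℝ × ℝ × ℝ, p.2.1 < 1/2 → level p.2.1 ≠ 0 →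
      ‖form φ p‖ ≤ C * (3/4) ^ level p.2.1 := by
  obtain ⟨C, hC1, hC2⟩ := exists_bound_step h
  have hC0 : 0 ≤ C := (abs_nonneg _).trans (hC1 0)
  refine ⟨C * 1000, by positivity, fun p hp hk => ?_⟩
  rw [form, if_pos hp, norm_smul, Real.norm_of_nonneg cutoff.nonneg]
  refine (mul_le_of_le_one_left (norm_nonneg _) cutoff.le_one).trans ?_
  have e := (preform_eventuallyEq
    (lift_eventuallyEq h.eq_zero h.eq_one (primQ_compat (step φ)) hp)
    (lift_eventuallyEq h.eq_zero h.eq_one (vertQ_compat (step φ)) hp)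
    (lift_eventuallyEq h.eq_zero h.eq_one psiQ_compat hp)).eq_of_nhds
  rw [rawForm, e]
  exact norm_preform_piece_le h.smooth h.mem_Icc h.deriv_nonneg h.deriv_le (step_contDiff h)
    hC1 hC2 hk p

lemma le_level {N : ℕ} {y : ℝ} (h0 : ySeq (1/3) N ≤ y) (h1 : y < 1/2) : N ≤ level y := by
  have hN : ySeq (1/3) 0 ≤ ySeq (1/3) N := ySeq_third_strictMono.monotone (Nat.zero_le N)
  have y0 : ySeq (1/3) 0 = 0 := by simp [ySeq]
  obtain ⟨k, hk, hk'⟩ := exists_level (y := y) (by linarith) h1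
  rw [level_eq hk hk']
  exact Nat.lt_succ_iff.1 (ySeq_third_strictMono.lt_iff_lt.1 (h0.trans_lt hk'))

lemma form_eventually_zero_of_gt {φ : ℝ → ℝ} {p : ℝ × ℝ × ℝ} (hp : 1/2 < p.2.1) :
    form φ =ᶠ[𝓝 p] 0 := by
  have hc : ContinuousAt (fun q : ℝ × ℝ × ℝ => q.2.1) p := by fun_prop
  filter_upwards [hc.eventually_const_lt hp] with q hq
  exact form_eq_zero_of_le (le_of_lt hq)

lemma continuous_form {φ : ℝ → ℝ} (h : IsTransition φ) : Continuous (form φ) := by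
  refine continuous_iff_continuousAt.2 fun p => ?_
  rcases lt_trichotomy p.2.1 (1/2) with hp | hp | hp
  · exact (contDiffAt_form h hp).continuousAt
  · obtain ⟨C, hC0, hC⟩ := exists_norm_form_le h
    rw [ContinuousAt, form_eq_zero_of_le hp.ge, tendsto_zero_iff_norm_tendsto_zero]
    refine Metric.tendsto_nhds.2 fun ε hε => ?_
    have hlim : Tendsto (fun n : ℕ => C * (3/4 : ℝ) ^ n) atTop (𝓝 0) := by
      simpa using (tendsto_pow_atTop_nhds_zero_of_lt_one (by norm_num : (0:ℝ) ≤ 3/4)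
        (by norm_num)).const_mul C
    obtain ⟨N, hN, hN1⟩ := ((hlim.eventually_lt_const hε).and (eventually_ge_atTop 1)).exists
    have hc : ContinuousAt (fun q : ℝ × ℝ × ℝ => q.2.1) p := by fun_prop
    filter_upwards [hc.eventually_const_lt (hp ▸ ySeq_third_lt N)] with q hq
    rw [dist_zero_right, norm_norm]
    by_cases hq' : q.2.1 < 1/2
    · have hl := le_level (le_of_lt hq) hq'
      refine (hC q hq' (by omega)).trans_lt (lt_of_le_of_lt ?_ hN)
      exact mul_le_mul_of_nonneg_left
        (pow_le_pow_of_le_one (by norm_num) (by norm_num) hl) hC0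
    · rw [form_eq_zero_of_le (not_lt.1 hq')]
      simpa using hε
  · exact continuousAt_const.congr (form_eventually_zero_of_gt hp).symm

lemma contDiffOn_form {φ : ℝ → ℝ} (h : IsTransition φ) : ContDiffOn ℝ 1 (form φ) Esegᶜ := by
  intro p hp
  refine ContDiffAt.contDiffWithinAt ?_
  have key : form φ =ᶠ[𝓝 p] 0 → ContDiffAt ℝ 1 (form φ) p := fun h0 =>
    contDiffAt_const.congr_of_eventuallyEq h0
  rcases lt_trichotomy p.2.1 (1/2) with hy | hy | hy
  · exact contDiffAt_form h hy
  · have hcx : ContinuousAt (fun q : ℝ × ℝ × ℝ => q.1) p := by fun_prop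
    have hcz : ContinuousAt (fun q : ℝ × ℝ × ℝ => |q.2.2|) p := by fun_prop
    by_cases hx : p.1 ∈ Icc 0 π
    · have hz : 1 < |p.2.2| := by
        by_contra hz
        exact hp ⟨hx, hy.trans yInf_third.symm, abs_le.1 (not_lt.1 hz)⟩
      refine key ?_
      filter_upwards [hcz.eventually_const_lt hz] with q hq
      exact form_eq_zero_of_one_le (le_of_lt hq)
    · refine key ?_
      filter_upwards [hcx.eventually (isClosed_Icc.isOpen_compl.eventually_mem hx)] with q hq
      exact form_eq_zero h fun hq' => hq (Ioo_subset_Icc_self hq')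
  · exact key (form_eventually_zero_of_gt hy)

lemma mem_ker_of_mem_span {φ : ℝ → ℝ} (h : IsTransition φ) {x y z : ℝ}
    (hy : y ∈ Ioo (0:ℝ) (1/2)) {u : ℝ × ℝ × ℝ}
    (hu : u ∈ Submodule.span ℝ
      ({((1:ℝ), (0:ℝ), psi₁ (1/3) (1/3) (1/4) φ x y),
        ((0:ℝ), (1:ℝ), psi₂ (1/3) (1/3) (1/4) φ x y)} : Set (ℝ × ℝ × ℝ))) :
    (dz - fderiv ℝ (lift φ psiQ) (x, y, z)) u = 0 := by
  have hd : DifferentiableAt ℝ (lift φ psiQ) (x, y, z) :=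
    (contDiffAt_psiLift h hy.2).differentiableAt (by simp)
  have e1 : fderiv ℝ (lift φ psiQ) (x, y, z) (1, 0, 0) = psi₁ (1/3) (1/3) (1/4) φ x y := by
    rw [psi₁, ← (fderiv_apply_e1 hd).deriv]
    congr 1
    funext s
    exact (psi_eq_glue φ s hy.1.le hy.2).symm
  have e2 : fderiv ℝ (lift φ psiQ) (x, y, z) (0, 1, 0) = psi₂ (1/3) (1/3) (1/4) φ x y := by
    rw [psi₂, ← (fderiv_apply_e2 hd).deriv]
    refine Filter.EventuallyEq.deriv_eq ?_
    filter_upwards [isOpen_Ioo.eventually_mem hy] with s hs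
    exact (psi_eq_glue φ x hs.1.le hs.2).symm
  have e3 : fderiv ℝ (lift φ psiQ) (x, y, z) (0, 0, 1) = 0 :=
    (fderiv_apply_e3 hd).unique (hasDerivAt_const z (glue φ psiQ x y))
  suffices hle : Submodule.span ℝ
      ({((1:ℝ), (0:ℝ), psi₁ (1/3) (1/3) (1/4) φ x y),
        ((0:ℝ), (1:ℝ), psi₂ (1/3) (1/3) (1/4) φ x y)} : Set (ℝ × ℝ × ℝ))
      ≤ LinearMap.ker (dz - fderiv ℝ (lift φ psiQ) (x, y, z)).toLinearMap from hle hu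
  refine Submodule.span_le.2 ?_
  have d1 : ∀ s : ℝ, ((1, 0, s) : ℝ × ℝ × ℝ) = (1, 0, 0) + s • (0, 0, 1) := by simp
  have d2 : ∀ s : ℝ, ((0, 1, s) : ℝ × ℝ × ℝ) = (0, 1, 0) + s • (0, 0, 1) := by simp
  have z1 : ∀ a b c : ℝ, dz (a, b, c) = c := fun _ _ _ => rfl
  rintro w (rfl | rfl)
  · change dz _ - fderiv ℝ (lift φ psiQ) (x, y, z) _ = 0
    rw [z1, d1, map_add, map_smul, e1, e3]
    simp
  · change dz _ - fderiv ℝ (lift φ psiQ) (x, y, z) _ = 0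
    rw [z1, d2, map_add, map_smul, e2, e3]
    simp

lemma fderiv_form_symm {φ : ℝ → ℝ} (h : IsTransition φ) {p u v : ℝ × ℝ × ℝ}
    (hy : p.2.1 < 1/2) (hz : |p.2.2| < 1/2)
    (hu : (dz - fderiv ℝ (lift φ psiQ) p) u = 0) (hv : (dz - fderiv ℝ (lift φ psiQ) p) v = 0) :
    fderiv ℝ (form φ) p u v = fderiv ℝ (form φ) p v u := by
  have e : form φ =ᶠ[𝓝 p] rawForm φ := by
    have hcz : ContinuousAt (fun q : ℝ × ℝ × ℝ => |q.2.2|) p := by fun_prop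
    filter_upwards [eventually_lt_half hy, hcz.eventually_lt_const hz] with q h1 h2
    rw [form, if_pos h1, cutoff_eq_one (le_of_lt h2), one_smul]
  rw [e.fderiv_eq]
  exact fderiv_preform_symm (contDiffAt_primLift h hy) (contDiffAt_vertLift h hy)
    (contDiffAt_psiLift h hy) hu hv

lemma lift_zero {φ : ℝ → ℝ} (h : IsTransition φ) (Q : ℕ → ℝ → ℝ → ℝ) (x z : ℝ) :
    lift φ Q (x, 0, z) = Q 0 x 0 := by
  have hl : level 0 = 0 := level_eq (by simp [ySeq]) (by norm_num [ySeq])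
  obtain ⟨ε, hε, h0⟩ := h.eq_zero
  have hp : param φ 0 0 = 0 := h0 _ (by simpa [ySeq] using hε)
  simp only [lift, glue, hl, hp]

lemma integral_form_bottom {φ : ℝ → ℝ} (h : IsTransition φ) :
    ∫ t in (0:ℝ)..π, form φ (t, 0, 0) ((1:ℝ), (0:ℝ), (0:ℝ)) = 1 := by
  have hd : ∀ x ∈ uIcc 0 π, HasDerivAt (fun s => primQ (step φ) 0 s 0)
      (form φ (x, 0, 0) (1, 0, 0)) x := by
    intro x _
    have hy : ((x, 0, 0) : ℝ × ℝ × ℝ).2.1 < 1/2 := by norm_num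
    have h1 := fderiv_apply_e1 ((contDiffAt_primLift h hy).differentiableAt (by simp))
    have h2 := fderiv_apply_e1 ((contDiffAt_psiLift h hy).differentiableAt (by simp))
    simp only [lift_zero h] at h1 h2
    have h3 : (fun s => psiQ 0 s 0) = fun _ => 0 := by
      funext s; simp [psiQ, fSeq]
    rw [h3] at h2
    have h4 := h2.unique (hasDerivAt_const x (0:ℝ))
    refine h1.congr_deriv ?_
    have z1 : dz (1, 0, 0) = 0 := rfl
    rw [form, if_pos hy, cutoff_eq_one (by simp), one_smul, rawForm, preform, add_apply,
      smul_apply, sub_apply, h4, z1]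
    simp
  have hc : Continuous fun t : ℝ => form φ (t, 0, 0) ((1:ℝ), (0:ℝ), (0:ℝ)) :=
    ((continuous_form h).comp (by fun_prop)).clm_apply continuous_const
  rw [intervalIntegral.integral_eq_sub_of_hasDerivAt hd (hc.intervalIntegrable 0 π)]
  simp only [primQ, step_pi h, step_zero h, (deriv_step_eq_zero h (x := π) (by simp)).eq_of_nhds,
    (deriv_step_eq_zero h (x := 0) (by simp)).eq_of_nhds]
  simp

lemma abs_psi_le {φ : ℝ → ℝ} (h : IsTransition φ) (x : ℝ) {y : ℝ} (hy : y ∈ Ioo (0:ℝ) (1/2)) :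
    |psi (1/3) (1/3) (1/4) φ x y| ≤ 1/3 := by
  rw [psi_eq_glue φ x hy.1.le hy.2]
  exact abs_psiQ_le _ _ (h.mem_Icc _)

/-- With `a = h = 1/3`, `λ = 1/4` and any admissible transition function `φ`, there is a
`1`-form `ω` on `ℝ³` which is continuous on `ℝ³` and vanishes on the singular segment
`E = [0,π] × {y_∞} × [-1,1]`, is `C¹` on `ℝ³ ∖ E`, whose exterior derivative vanishes on
the tangent planes of the graph `M` of `ψ`, and whose circulation along the positively
oriented boundary of the rectangle `[0,π] × [0,y_∞] × {0}` equals `1` — so the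
generalized Stokes theorem fails for the integral current carried by the graph of `ψ`. -/
theorem stokes_counterexample
    (φ : ℝ → ℝ) (hφsmooth : ContDiff ℝ (⊤ : ℕ∞) φ) (hφmono : Monotone φ)
    (hφ01 : ∀ t, φ t ∈ Set.Icc (0:ℝ) 1)
    (hφd0 : ∀ t, 0 ≤ deriv φ t) (hφd2 : ∀ t, deriv φ t ≤ 2)
    (hφ0 : ∃ ε > 0, ∀ t < ε, φ t = 0) (hφ1 : ∃ ε > 0, ∀ t > 1 - ε, φ t = 1) :
    ∃ ω : ℝ × ℝ × ℝ → (ℝ × ℝ × ℝ →L[ℝ] ℝ),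
      -- (i) continuity on `ℝ³` and vanishing on `E`
      Continuous ω ∧ (∀ p ∈ Eseg, ω p = 0) ∧
      -- (ii) continuous differentiability away from `E`
      ContDiffOn ℝ 1 ω Esegᶜ ∧
      -- (iii) `dω` vanishes on the tangent planes of the graph of `ψ`
      (∀ x ∈ Ioo (0:ℝ) π, ∀ y ∈ Ioo (0:ℝ) (yInf (1/3)),
        ∀ u v : ℝ × ℝ × ℝ,
          u ∈ Submodule.span ℝ
              ({((1:ℝ), (0:ℝ), psi₁ (1/3) (1/3) (1/4) φ x y),
                ((0:ℝ), (1:ℝ), psi₂ (1/3) (1/3) (1/4) φ x y)} : Set (ℝ × ℝ × ℝ)) →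
          v ∈ Submodule.span ℝ
              ({((1:ℝ), (0:ℝ), psi₁ (1/3) (1/3) (1/4) φ x y),
                ((0:ℝ), (1:ℝ), psi₂ (1/3) (1/3) (1/4) φ x y)} : Set (ℝ × ℝ × ℝ)) →
          fderiv ℝ ω (x, y, psi (1/3) (1/3) (1/4) φ x y) u v
            = fderiv ℝ ω (x, y, psi (1/3) (1/3) (1/4) φ x y) v u) ∧
      -- (iv) the circulation along the boundary of the rectangle equals `1`
      (∫ t in (0:ℝ)..π, ω (t, 0, 0) ((1:ℝ), (0:ℝ), (0:ℝ)))
        + (∫ t in (0:ℝ)..yInf (1/3), ω (π, t, 0) ((0:ℝ), (1:ℝ), (0:ℝ)))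
        - (∫ t in (0:ℝ)..π, ω (t, yInf (1/3), 0) ((1:ℝ), (0:ℝ), (0:ℝ)))
        - (∫ t in (0:ℝ)..yInf (1/3), ω (0, t, 0) ((0:ℝ), (1:ℝ), (0:ℝ))) = 1 := by
  have h : IsTransition φ := ⟨hφsmooth, hφ01, hφd0, hφd2, hφ0, hφ1⟩
  refine ⟨form φ, continuous_form h, fun p hp => ?_, contDiffOn_form h, ?_, ?_⟩
  · have hy : p.2.1 = 1/2 := yInf_third ▸ hp.2.1
    exact form_eq_zero_of_le hy.ge
  · intro x _ y hy u v hu hv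
    rw [yInf_third] at hy
    exact fderiv_form_symm h hy.2 ((abs_psi_le h x hy).trans_lt (by norm_num))
      (mem_ker_of_mem_span h hy hu) (mem_ker_of_mem_span h hy hv)
  · have h2 : ∀ t, form φ (π, t, 0) = 0 := fun t => form_eq_zero h (by simp)
    have h3 : ∀ t, form φ (t, yInf (1/3), 0) = 0 := fun t =>
      form_eq_zero_of_le yInf_third.ge
    have h4 : ∀ t, form φ (0, t, 0) = 0 := fun t => form_eq_zero h (by simp)
    rw [integral_form_bottom h]
    simp only [h2, h3, h4, zero_apply, intervalIntegral.integral_zero]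
    norm_num

end StokesCounterexample
end
end
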